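/- Let S be the SJLT as in the context, let x, y ∈ ℝ^d be fixed, let ε > 0, and let η, μ ∈ ℝ^k have their 2k coordinates i.i.d. distributed as Lap(√s/ε), independently of S. Then the estimator Ê_SJLT := ‖(Sx+η) − (Sy+μ)‖₂² − 4k·s/ε² satisfies (1) E[Ê_SJLT] = ‖x−y‖₂², and (2) Var[Ê_SJLT] = (2/k)·(‖x−y‖₂⁴ − ‖x−y‖₄⁴) + 16·(s/ε²)·‖x−y‖₂² + 56·k·s²/ε⁴; in particular Var[Ê_SJLT] ≤ (2/k)·‖x−y‖₂⁴ + 16·(s/ε²)·‖x−y‖₂² + 56·k·s²/ε⁴. -/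

import Mathlib

open MeasureTheory ProbabilityTheory Finset
open scoped ENNReal NNReal

/-- Uniform distribution on `{-1, +1} ⊆ ℝ` (law of a random sign `φ_r(j)`). -/
noncomputable def signMeasure : Measure ℝ :=
  ((2 : ℝ≥0)⁻¹) • Measure.dirac (-1) + ((2 : ℝ≥0)⁻¹) • Measure.dirac 1

instance : IsFiniteMeasure signMeasure := by unfold signMeasure; infer_instance

/-- Law of a single pair `(h_r(j), φ_r(j))`: `h_r(j)` uniform on `Fin c`, independently
`φ_r(j)` uniform on `{-1, +1}`. -/
noncomputable def hashSignMeasure (c : ℕ) [NeZero c] : Measure (Fin c × ℝ) :=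
  ((PMF.uniformOfFintype (Fin c)).toMeasure).prod signMeasure

/-- The `((i,r), j)` entry of the SJLT matrix given the realization `G` of all
hash/sign pairs: `S_{(i,r),j} = s^{-1/2} · φ_r(j) · 1[h_r(j) = i]`, where
`h_r(j) = (G (r,j)).1` and `φ_r(j) = (G (r,j)).2`. -/
noncomputable def sjltEntry {s c d : ℕ} (G : (Fin s × Fin d) → Fin c × ℝ)
    (i : Fin c) (r : Fin s) (j : Fin d) : ℝ :=
  (Real.sqrt s)⁻¹ * (G (r, j)).2 * (if (G (r, j)).1 = i then 1 else 0)

/-- The centered Laplace distribution on `ℝ` with scale `b`, given by the density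
`t ↦ (2b)⁻¹ * exp (-|t|/b)` with respect to Lebesgue measure. -/
noncomputable def laplaceMeasure (b : ℝ) : Measure ℝ :=
  MeasureTheory.volume.withDensity fun t => ENNReal.ofReal ((2 * b)⁻¹ * Real.exp (-|t| / b))

instance (b : ℝ) : SigmaFinite (laplaceMeasure b) :=
  SigmaFinite.withDensity_ofReal _

/-- `V` is a centred random vector with finite fourth moments, second moment matrix `M`, and
`Var ‖V‖² = κ + 2 ‖M‖_F²`. Both `M` and `κ` are additive over independent vectors. -/
structure HasNormMoments {Ω P : Type*} [MeasurableSpace Ω] [Fintype P] (V : Ω → P → ℝ)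
    (μ : Measure Ω) (M : P → P → ℝ) (κ : ℝ) : Prop where
  measurable : Measurable V
  memLp : ∀ p, MemLp (fun ω => V ω p) 4 μ
  mean : ∀ p, ∫ ω, V ω p ∂μ = 0
  second : ∀ p q, ∫ ω, V ω p * V ω q ∂μ = M p q
  fourth : ∫ ω, (∑ p, V ω p ^ 2) ^ 2 ∂μ = κ + 2 * ∑ p, ∑ q, M p q ^ 2 + (∑ p, M p p) ^ 2

namespace HasNormMoments

variable {Ω Ω' P : Type*} [MeasurableSpace Ω] [MeasurableSpace Ω'] [Fintype P]
  {μ : Measure Ω} {ν : Measure Ω'} {T V : Ω → P → ℝ} {M M' : P → P → ℝ} {κ κ' : ℝ}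

lemma memLp_mul (hV : HasNormMoments V μ M κ) (p q : P) :
    MemLp (fun ω => V ω p * V ω q) 2 μ := by
  have : ENNReal.HolderTriple 4 4 2 := ⟨by
    rw [← two_mul, show (4 : ℝ≥0∞) = 2 * 2 by norm_num, ENNReal.mul_inv (by simp) (by simp),
      ← mul_assoc, ENNReal.mul_inv_cancel (by simp) (by simp), one_mul]⟩
  exact (hV.memLp q).mul' (hV.memLp p)

lemma memLp_normSq (hV : HasNormMoments V μ M κ) :
    MemLp (fun ω => ∑ p, V ω p ^ 2) 2 μ := by
  refine memLp_finsetSum _ fun p _ => ?_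
  simpa only [sq] using hV.memLp_mul p p

lemma integrable_mul [IsFiniteMeasure μ] (hV : HasNormMoments V μ M κ) (p q : P) :
    Integrable (fun ω => V ω p * V ω q) μ :=
  (hV.memLp_mul p q).integrable (by norm_num)

lemma integrable [IsFiniteMeasure μ] (hV : HasNormMoments V μ M κ) (p : P) :
    Integrable (fun ω => V ω p) μ :=
  (hV.memLp p).integrable (by norm_num)

lemma integrable_normSq_mul [IsFiniteMeasure μ] (hV : HasNormMoments V μ M κ) (p : P) :
    Integrable (fun ω => (∑ q, V ω q ^ 2) * V ω p) μ :=
  hV.memLp_normSq.integrable_mul ((hV.memLp p).mono_exponent (p := 2) (by norm_num))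

lemma integral_normSq [IsFiniteMeasure μ] (hV : HasNormMoments V μ M κ) :
    ∫ ω, ∑ p, V ω p ^ 2 ∂μ = ∑ p, M p p := by
  simp only [sq]
  rw [integral_finsetSum _ fun p _ => hV.integrable_mul p p]
  simp only [hV.second]

lemma variance_normSq [IsProbabilityMeasure μ] (hV : HasNormMoments V μ M κ) :
    variance (fun ω => ∑ p, V ω p ^ 2) μ = κ + 2 * ∑ p, ∑ q, M p q ^ 2 := by
  rw [variance_eq_sub hV.memLp_normSq, hV.integral_normSq]
  simp only [Pi.pow_apply]
  rw [hV.fourth]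
  ring

lemma comp {V : Ω' → P → ℝ} (hV : HasNormMoments V ν M κ) {X : Ω → Ω'}
    (hX : MeasurePreserving X μ ν) : HasNormMoments (fun ω => V (X ω)) μ M κ where
  measurable := hV.measurable.comp hX.measurable
  memLp p := (hV.memLp p).comp_measurePreserving hX
  mean p := by
    rw [← hV.mean p, ← hX.map_eq, integral_map hX.aemeasurable]
    rw [hX.map_eq]; exact (hV.memLp p).aestronglyMeasurable
  second p q := by
    rw [← hV.second p q, ← hX.map_eq, integral_map hX.aemeasurable]
    rw [hX.map_eq]; exact (hV.memLp_mul p q).aestronglyMeasurable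
  fourth := by
    rw [← hV.fourth, ← hX.map_eq, integral_map hX.aemeasurable]
    rw [hX.map_eq]; exact hV.memLp_normSq.integrable_sq.aestronglyMeasurable

lemma zero [IsProbabilityMeasure μ] : HasNormMoments (0 : Ω → P → ℝ) μ 0 0 where
  measurable := measurable_const
  memLp p := by simp
  mean p := by simp
  second p q := by simp
  fourth := by simp

lemma add [IsProbabilityMeasure μ] (hT : HasNormMoments T μ M κ)
    (hV : HasNormMoments V μ M' κ') (h : IndepFun T V μ) :
    HasNormMoments (T + V) μ (M + M') (κ + κ') := by
  have indep {f g : (P → ℝ) → ℝ} (hf : Measurable f) (hg : Measurable g) :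
      IndepFun (fun ω => f (T ω)) (fun ω => g (V ω)) μ := h.comp hf hg
  have integrable_prod {f g : (P → ℝ) → ℝ} (hf : Measurable f) (hg : Measurable g)
      (hfi : Integrable (fun ω => f (T ω)) μ) (hgi : Integrable (fun ω => g (V ω)) μ) :
      Integrable (fun ω => f (T ω) * g (V ω)) μ := (indep hf hg).integrable_mul hfi hgi
  have heq {f g : (P → ℝ) → ℝ} (hf : Measurable f) (hg : Measurable g) :
      ∫ ω, f (T ω) * g (V ω) ∂μ = (∫ ω, f (T ω) ∂μ) * ∫ ω, g (V ω) ∂μ :=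
    (indep hf hg).integral_fun_mul_eq_mul_integral
      (hf.comp hT.measurable).aestronglyMeasurable (hg.comp hV.measurable).aestronglyMeasurable
  have m1 (p : P) : Measurable fun v : P → ℝ => v p := measurable_pi_apply p
  have m2 (p q : P) : Measurable fun v : P → ℝ => v p * v q := (m1 p).mul (m1 q)
  have mN : Measurable fun v : P → ℝ => ∑ p, v p ^ 2 :=
    Finset.measurable_sum _ fun p _ => (m1 p).pow_const 2
  have m3 (p : P) : Measurable fun v : P → ℝ => (∑ q, v q ^ 2) * v p := mN.mul (m1 p)
  refine ⟨hT.measurable.add hV.measurable, fun p => (hT.memLp p).add (hV.memLp p), fun p => ?_,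
    fun p q => ?_, ?_⟩
  · simp only [Pi.add_apply]
    rw [integral_add (hT.integrable p) (hV.integrable p), hT.mean, hV.mean, add_zero]
  · have e : ∀ ω, (T + V) ω p * (T + V) ω q
        = (T ω p * T ω q + V ω p * V ω q) + (T ω p * V ω q + T ω q * V ω p) := fun ω => by
      simp only [Pi.add_apply]; ring
    simp only [e]
    have i1 := integrable_prod (m1 p) (m1 q) (hT.integrable p) (hV.integrable q)
    have i2 := integrable_prod (m1 q) (m1 p) (hT.integrable q) (hV.integrable p)
    rw [integral_add ((hT.integrable_mul p q).fun_add (hV.integrable_mul p q)) (i1.fun_add i2),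
      integral_add (hT.integrable_mul p q) (hV.integrable_mul p q), integral_add i1 i2,
      heq (m1 p) (m1 q), heq (m1 q) (m1 p), hT.second, hV.second, hT.mean, hT.mean]
    simp
  · have e : ∀ ω, (∑ p, (T + V) ω p ^ 2) ^ 2
        = (∑ p, T ω p ^ 2) ^ 2 + (∑ p, V ω p ^ 2) ^ 2
          + 2 * ((∑ p, T ω p ^ 2) * (∑ p, V ω p ^ 2))
          + 4 * (∑ p, ∑ q, (T ω p * T ω q) * (V ω p * V ω q))
          + 4 * (∑ p, ((∑ q, T ω q ^ 2) * T ω p) * V ω p)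
          + 4 * (∑ p, T ω p * ((∑ q, V ω q ^ 2) * V ω p)) := fun ω => by
      have e0 : ∑ p, (T + V) ω p ^ 2
          = ∑ p, T ω p ^ 2 + ∑ p, V ω p ^ 2 + 2 * ∑ p, T ω p * V ω p := by
        rw [mul_sum, ← sum_add_distrib, ← sum_add_distrib]
        exact sum_congr rfl fun p _ => by simp only [Pi.add_apply]; ring
      have e1 : ∑ p, ∑ q, (T ω p * T ω q) * (V ω p * V ω q) = (∑ p, T ω p * V ω p) ^ 2 := by
        rw [sq, sum_mul_sum]
        exact sum_congr rfl fun p _ => sum_congr rfl fun q _ => by ring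
      have e2 : ∑ p, ((∑ q, T ω q ^ 2) * T ω p) * V ω p
          = (∑ q, T ω q ^ 2) * ∑ p, T ω p * V ω p := by
        rw [mul_sum]; exact sum_congr rfl fun p _ => by ring
      have e3 : ∑ p, T ω p * ((∑ q, V ω q ^ 2) * V ω p)
          = (∑ q, V ω q ^ 2) * ∑ p, T ω p * V ω p := by
        rw [mul_sum]; exact sum_congr rfl fun p _ => by ring
      rw [e0, e1, e2, e3]; ring
    simp only [e]
    have iT := hT.memLp_normSq.integrable_sq
    have iV := hV.memLp_normSq.integrable_sq
    have iTV := (integrable_prod mN mN (hT.memLp_normSq.integrable (by norm_num))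
      (hV.memLp_normSq.integrable (by norm_num))).const_mul 2
    have i4 (p q : P) := integrable_prod (m2 p q) (m2 p q) (hT.integrable_mul p q) (hV.integrable_mul p q)
    have i5 (p : P) := integrable_prod (m3 p) (m1 p) (hT.integrable_normSq_mul p) (hV.integrable p)
    have i6 (p : P) := integrable_prod (m1 p) (m3 p) (hT.integrable p) (hV.integrable_normSq_mul p)
    have s4' (p : P) := integrable_finsetSum univ fun q _ => i4 p q
    have s4 := (integrable_finsetSum univ fun p _ => s4' p).const_mul 4
    have s5 := (integrable_finsetSum univ fun p _ => i5 p).const_mul 4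
    have s6 := (integrable_finsetSum univ fun p _ => i6 p).const_mul 4
    have v4 : ∫ ω, ∑ p, ∑ q, (T ω p * T ω q) * (V ω p * V ω q) ∂μ
        = ∑ p, ∑ q, M p q * M' p q := by
      rw [integral_finsetSum _ fun p _ => s4' p]
      refine sum_congr rfl fun p _ => ?_
      rw [integral_finsetSum _ fun q _ => i4 p q]
      refine sum_congr rfl fun q _ => ?_
      rw [heq (m2 p q) (m2 p q), hT.second, hV.second]
    have v5 : ∫ ω, ∑ p, ((∑ q, T ω q ^ 2) * T ω p) * V ω p ∂μ = 0 := by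
      rw [integral_finsetSum _ fun p _ => i5 p]
      refine sum_eq_zero fun p _ => ?_
      rw [heq (m3 p) (m1 p), hV.mean, mul_zero]
    have v6 : ∫ ω, ∑ p, T ω p * ((∑ q, V ω q ^ 2) * V ω p) ∂μ = 0 := by
      rw [integral_finsetSum _ fun p _ => i6 p]
      refine sum_eq_zero fun p _ => ?_
      rw [heq (m1 p) (m3 p), hT.mean, zero_mul]
    rw [integral_add ((((iT.fun_add iV).fun_add iTV).fun_add s4).fun_add s5) s6,
      integral_add (((iT.fun_add iV).fun_add iTV).fun_add s4) s5,
      integral_add ((iT.fun_add iV).fun_add iTV) s4, integral_add (iT.fun_add iV) iTV, integral_add iT iV]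
    simp only [integral_const_mul]
    rw [v4, v5, v6, hT.fourth, hV.fourth, heq mN mN, hT.integral_normSq, hV.integral_normSq]
    have e7 : ∑ p, ∑ q, (M + M') p q ^ 2 = ∑ p, ∑ q, M p q ^ 2 + ∑ p, ∑ q, M' p q ^ 2
        + 2 * ∑ p, ∑ q, M p q * M' p q := by
      simp only [mul_sum, ← sum_add_distrib]
      exact sum_congr rfl fun p _ => sum_congr rfl fun q _ => by
        simp only [Pi.add_apply]; ring
    rw [e7]
    simp only [Pi.add_apply, sum_add_distrib]
    ring

lemma sum [IsProbabilityMeasure μ] {ι : Type*} {V : ι → Ω → P → ℝ} {M : ι → P → P → ℝ}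
    {κ : ι → ℝ} (hV : ∀ i, HasNormMoments (V i) μ (M i) (κ i)) (h : iIndepFun V μ)
    (s : Finset ι) :
    HasNormMoments (∑ i ∈ s, V i) μ (∑ i ∈ s, M i) (∑ i ∈ s, κ i) := by
  classical
  induction s using Finset.induction_on with
  | empty => simpa using zero
  | insert a s ha ih =>
    rw [sum_insert ha, sum_insert ha, sum_insert ha, add_comm (V a), add_comm (M a),
      add_comm (κ a)]
    exact ih.add (hV a) (h.indepFun_finsetSum_of_notMem (fun i => (hV i).measurable) ha)

/-- Summing functions of the separate coordinates of a product measure. -/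
lemma pi_sum {ι E : Type*} [Fintype ι] [MeasurableSpace E] {ρ : Measure E}
    [IsProbabilityMeasure ρ] {V : ι → E → P → ℝ} {M : ι → P → P → ℝ} {κ : ι → ℝ}
    (hV : ∀ i, HasNormMoments (V i) ρ (M i) (κ i)) :
    HasNormMoments (fun g : ι → E => ∑ i, V i (g i)) (Measure.pi fun _ => ρ)
      (∑ i, M i) (∑ i, κ i) := by
  have := sum (fun i => (hV i).comp (measurePreserving_eval (fun _ : ι => ρ) i))
    (iIndepFun_pi fun i => (hV i).measurable.aemeasurable) univ
  convert this using 1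
  ext g p
  simp

end HasNormMoments

lemma integral_signMeasure (f : ℝ → ℝ) : ∫ t, f t ∂signMeasure = (f (-1) + f 1) / 2 := by
  have hd (a : ℝ) : Integrable f (((2 : ℝ≥0)⁻¹) • Measure.dirac a) :=
    (integrable_dirac (by simp)).smul_measure_nnreal
  rw [signMeasure, integral_add_measure (hd _) (hd _), integral_smul_nnreal_measure,
    integral_smul_nnreal_measure, integral_dirac, integral_dirac]
  simp only [NNReal.smul_def, NNReal.coe_inv, NNReal.coe_ofNat, smul_eq_mul]
  ring

instance : IsProbabilityMeasure signMeasure := by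
  constructor
  simp only [signMeasure, Measure.add_apply, Measure.smul_apply, measure_univ]
  simp [ENNReal.smul_def, ENNReal.inv_two_add_inv_two]

instance (c : ℕ) [NeZero c] : IsProbabilityMeasure (hashSignMeasure c) := by
  unfold hashSignMeasure; infer_instance

lemma memLp_id_signMeasure (p : ℝ≥0∞) : MemLp (fun t : ℝ => t) p signMeasure := by
  refine MemLp.of_bound measurable_id.aestronglyMeasurable 1 ?_
  rw [signMeasure, ae_add_measure_iff]
  constructor <;> refine Measure.ae_smul_measure ?_ _ <;> simp [ae_dirac_eq]

lemma integral_hashSignMeasure_mul {c : ℕ} [NeZero c] (f : Fin c → ℝ) (g : ℝ → ℝ) :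
    ∫ w, f w.1 * g w.2 ∂hashSignMeasure c
      = ((∑ i, f i) / c) * ((g (-1) + g 1) / 2) := by
  rw [hashSignMeasure, integral_prod_mul, integral_signMeasure, PMF.integral_eq_sum]
  simp [← mul_sum, div_eq_inv_mul]

/-- A signed hash value, scaled by `a` and placed in the block `r` of the sketch. -/
lemma hasNormMoments_hashSign {s c : ℕ} [NeZero c] (a : ℝ) (r : Fin s) :
    HasNormMoments (fun (w : Fin c × ℝ) (p : Fin c × Fin s) =>
        if p = (w.1, r) then a * w.2 else 0) (hashSignMeasure c)
      (fun p q => if p = q ∧ p.2 = r then a ^ 2 / c else 0) (-(2 * a ^ 4 / c)) := by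
  have hc : (c : ℝ) ≠ 0 := NeZero.ne _
  have meas (p : Fin c × Fin s) :
      Measurable fun w : Fin c × ℝ => if p = (w.1, r) then a * w.2 else 0 := by
    refine Measurable.ite ?_ (by fun_prop) measurable_const
    exact measurable_fst (Set.toFinite {i : Fin c | p = (i, r)}).measurableSet
  refine ⟨measurable_pi_lambda _ meas, fun p => ?_, fun p => ?_, fun p q => ?_, ?_⟩
  · refine MemLp.mono (((memLp_id_signMeasure 4).comp_measurePreserving
      (measurePreserving_snd (μ := (PMF.uniformOfFintype (Fin c)).toMeasure))).const_mul a)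
      (meas p).aestronglyMeasurable (Filter.Eventually.of_forall fun w => ?_)
    split_ifs
    · simp
    · simp [mul_nonneg]
  · have e (w : Fin c × ℝ) : (if p = (w.1, r) then a * w.2 else 0)
        = (if p = (w.1, r) then a else 0) * w.2 := by split_ifs <;> simp
    simp only [e]
    rw [integral_hashSignMeasure_mul (fun i => if p = (i, r) then a else 0) fun t => t]
    simp
  · have e (w : Fin c × ℝ) : (if p = (w.1, r) then a * w.2 else 0)
          * (if q = (w.1, r) then a * w.2 else 0)
        = (if p = (w.1, r) ∧ q = (w.1, r) then a ^ 2 else 0) * w.2 ^ 2 := by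
      split_ifs <;> simp_all; ring
    simp only [e]
    rw [integral_hashSignMeasure_mul
      (fun i => if p = (i, r) ∧ q = (i, r) then a ^ 2 else 0) fun t => t ^ 2]
    have e' (i : Fin c) : (if p = (i, r) ∧ q = (i, r) then a ^ 2 else 0)
        = if p.1 = i then (if p = q ∧ p.2 = r then a ^ 2 else 0) else 0 := by
      rcases p with ⟨p1, p2⟩
      rcases q with ⟨q1, q2⟩
      simp only [Prod.mk.injEq]
      split_ifs <;> grind
    simp only [e']
    rw [sum_ite_eq]
    split_ifs <;> simp_all
  · have e (w : Fin c × ℝ) :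
        (∑ p : Fin c × Fin s, (if p = (w.1, r) then a * w.2 else 0) ^ 2) ^ 2
        = 1 * (a * w.2) ^ 4 := by
      simp [ite_pow]; ring
    simp only [e]
    rw [integral_hashSignMeasure_mul (fun _ => 1) fun t => (a * t) ^ 4]
    simp [Fintype.sum_prod_type, ite_and, ite_pow]
    field_simp
    ring

lemma integral_pow_mul_laplace_density {b : ℝ} (hb : 0 < b) {n : ℕ} (hn : Even n) :
    ∫ t : ℝ, ((2 * b)⁻¹ * Real.exp (-|t| / b)) * t ^ n = n.factorial * b ^ n := by
  have e (t : ℝ) : ((2 * b)⁻¹ * Real.exp (-|t| / b)) * t ^ n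
      = (fun u : ℝ => (2 * b)⁻¹ * (u ^ n * Real.exp (-(b⁻¹ * u)))) |t| := by
    simp only [hn.pow_abs]
    rw [neg_div, div_eq_inv_mul]
    ring
  simp only [e]
  rw [integral_comp_abs (f := fun u : ℝ => (2 * b)⁻¹ * (u ^ n * Real.exp (-(b⁻¹ * u)))),
    integral_const_mul]
  have h := Real.integral_rpow_mul_exp_neg_mul_Ioi (a := n + 1) (by positivity) (inv_pos.2 hb)
  simp only [add_sub_cancel_right, Real.rpow_natCast, one_div, inv_inv,
    Real.Gamma_nat_eq_factorial] at h
  rw [h, show ((n : ℝ) + 1) = ((n + 1 : ℕ) : ℝ) by push_cast; rfl, Real.rpow_natCast, pow_succ]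
  field_simp

lemma integral_laplaceMeasure {b : ℝ} (hb : 0 < b) (f : ℝ → ℝ) :
    ∫ t, f t ∂laplaceMeasure b = ∫ t, ((2 * b)⁻¹ * Real.exp (-|t| / b)) * f t := by
  rw [laplaceMeasure, integral_withDensity_eq_integral_toReal_smul (by fun_prop) (by simp)]
  refine integral_congr_ae (Filter.Eventually.of_forall fun t => ?_)
  simp only [smul_eq_mul]
  rw [ENNReal.toReal_ofReal (by positivity)]

lemma integral_pow_laplaceMeasure {b : ℝ} (hb : 0 < b) {n : ℕ} (hn : Even n) :
    ∫ t, t ^ n ∂laplaceMeasure b = n.factorial * b ^ n := by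
  rw [integral_laplaceMeasure hb, integral_pow_mul_laplace_density hb hn]

lemma integral_id_laplaceMeasure {b : ℝ} (hb : 0 < b) : ∫ t, t ∂laplaceMeasure b = 0 := by
  rw [integral_laplaceMeasure hb]
  have h := integral_neg_eq_self (fun t : ℝ => ((2 * b)⁻¹ * Real.exp (-|t| / b)) * t) volume
  simp only [abs_neg, mul_neg, integral_neg] at h
  linarith

lemma isProbabilityMeasure_laplaceMeasure {b : ℝ} (hb : 0 < b) :
    IsProbabilityMeasure (laplaceMeasure b) := by
  have h := integral_pow_laplaceMeasure hb (n := 0) (by simp)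
  simp only [pow_zero, integral_const, smul_eq_mul, mul_one, Nat.factorial_zero,
    Nat.cast_one] at h
  exact ⟨by simpa [Measure.real, ENNReal.toReal_eq_one_iff] using h⟩

lemma memLp_id_laplaceMeasure {b : ℝ} (hb : 0 < b) :
    MemLp (fun t : ℝ => t) 4 (laplaceMeasure b) := by
  have h : Integrable (fun t : ℝ => t ^ 4) (laplaceMeasure b) := .of_integral_ne_zero (by
    rw [integral_pow_laplaceMeasure hb (by decide)]; positivity)
  refine (integrable_norm_rpow_iff measurable_id.aestronglyMeasurable
    (by norm_num) (by norm_num)).1 (h.congr (Filter.Eventually.of_forall fun t => ?_))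
  have h4 : (4 : ℝ≥0∞).toReal = ((4 : ℕ) : ℝ) := by simp
  simp only [h4, Real.rpow_natCast, Real.norm_eq_abs]
  exact ((by decide : Even 4).pow_abs t).symm

/-- A signed Laplace variable placed in the coordinate `q₀`. -/
lemma hasNormMoments_laplace {P : Type*} [Fintype P] [DecidableEq P] {b : ℝ} (hb : 0 < b)
    (q₀ : P) {σ : ℝ} (hσ : σ ^ 2 = 1) :
    HasNormMoments (fun (t : ℝ) (p : P) => if p = q₀ then σ * t else 0) (laplaceMeasure b)
      (fun p q => if p = q ∧ p = q₀ then 2 * b ^ 2 else 0) (12 * b ^ 4) := by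
  refine ⟨measurable_pi_lambda _ fun p => ?_, fun p => ?_, fun p => ?_, fun p q => ?_, ?_⟩
  · split_ifs <;> fun_prop
  · split_ifs
    · exact (memLp_id_laplaceMeasure hb).const_mul σ
    · simp
  · split_ifs
    · rw [integral_const_mul, integral_id_laplaceMeasure hb, mul_zero]
    · simp
  · have e (t : ℝ) : (if p = q₀ then σ * t else 0) * (if q = q₀ then σ * t else 0)
        = (if p = q ∧ p = q₀ then 1 else 0) * t ^ 2 := by
      split_ifs <;> grind
    simp only [e]
    rw [integral_const_mul, integral_pow_laplaceMeasure hb even_two]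
    split_ifs <;> simp
  · have e (t : ℝ) : (∑ p, (if p = q₀ then σ * t else 0) ^ 2) ^ 2 = t ^ 4 := by
      simp [ite_pow, mul_pow, hσ]; ring
    simp only [e]
    rw [integral_pow_laplaceMeasure hb (by decide)]
    simp [ite_and, ite_pow, Nat.factorial]
    ring

/-- The contribution of the sketch `S z` to the moments of the noisy sketch. -/
lemma hasNormMoments_sjlt {s c d : ℕ} [NeZero s] [NeZero c] (z : Fin d → ℝ) :
    HasNormMoments (fun (g : Fin s × Fin d → Fin c × ℝ) (p : Fin c × Fin s) =>
        ∑ j, sjltEntry g p.1 p.2 j * z j) (Measure.pi fun _ => hashSignMeasure c)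
      (fun p q => if p = q then (∑ j, z j ^ 2) / (c * s) else 0)
      (-(2 / (c * s) * ∑ j, z j ^ 4)) := by
  have hs : (s : ℝ) ≠ 0 := NeZero.ne _
  have hc : (c : ℝ) ≠ 0 := NeZero.ne _
  have hsq : (√(s : ℝ)) ^ 2 = s := Real.sq_sqrt (Nat.cast_nonneg s)
  have hsq4 : (√(s : ℝ)) ^ 4 = s ^ 2 := by
    rw [show 4 = 2 * 2 from rfl, pow_mul, hsq]
  have h := HasNormMoments.pi_sum fun a : Fin s × Fin d =>
    hasNormMoments_hashSign (c := c) ((√(s : ℝ))⁻¹ * z a.2) a.1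
  convert h using 1
  · ext g ⟨i, r⟩
    simp only [Finset.sum_apply, Fintype.sum_prod_type, Prod.mk.injEq, sjltEntry]
    rw [sum_comm]
    refine sum_congr rfl fun j _ => ?_
    rw [Fintype.sum_eq_single r fun t ht => if_neg fun h => ht h.2.symm]
    simp only [and_true, eq_comm (a := i)]
    split_ifs <;> ring
  · ext p q
    simp only [Finset.sum_apply, Fintype.sum_prod_type]
    rw [sum_comm]
    by_cases hpq : p = q
    · simp only [hpq, true_and, sum_ite_eq, mem_univ, if_true, mul_pow, inv_pow, hsq, sum_div]
      refine sum_congr rfl fun j _ => ?_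
      field_simp
    · simp [hpq]
  · simp only [Fintype.sum_prod_type, mul_pow, inv_pow, hsq4, sum_neg_distrib, sum_const,
      card_univ, Fintype.card_fin, nsmul_eq_mul, mul_sum]
    refine congrArg _ (sum_congr rfl fun j _ => ?_)
    field_simp

/-- The contribution of the difference of two Laplace noise vectors. -/
lemma hasNormMoments_noise {P : Type*} [Fintype P] [DecidableEq P] {b : ℝ} (hb : 0 < b) :
    HasNormMoments (fun (n : P ⊕ P → ℝ) (p : P) => n (Sum.inl p) - n (Sum.inr p))
      (Measure.pi fun _ => laplaceMeasure b)
      (fun p q => if p = q then 4 * b ^ 2 else 0) (24 * Fintype.card P * b ^ 4) := by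
  have := isProbabilityMeasure_laplaceMeasure hb
  have h := HasNormMoments.pi_sum fun a : P ⊕ P =>
    hasNormMoments_laplace hb (a.elim id id) (σ := a.elim (fun _ => 1) fun _ => -1)
      (by cases a <;> simp)
  convert h using 1
  · ext n p
    simp [Finset.sum_apply, sub_eq_add_neg]
  · ext p q
    by_cases hpq : p = q
    · simp only [hpq, Finset.sum_apply, Fintype.sum_sum_type]
      rw [Fintype.sum_eq_single q fun x hx => if_neg fun h => hx h.2.symm,
        Fintype.sum_eq_single q fun x hx => if_neg fun h => hx h.2.symm]
      simp only [Sum.elim_inl, Sum.elim_inr, id, and_self, if_true]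
      ring
    · simp [hpq, Finset.sum_apply]
  · simp; ring

/-- For the SJLT `S` (with `k = c·s`), fixed `x, y ∈ ℝ^d`, `ε > 0`, and
noise `η = N ∘ Sum.inl`, `μ = N ∘ Sum.inr` whose `2k` coordinates are i.i.d.
`Lap(√s/ε)`, independent of `S`, the estimator
`Ê_SJLT = ‖(Sx+η) − (Sy+μ)‖₂² − 4ks/ε²` satisfies
(1) `E[Ê_SJLT] = ‖x−y‖₂²`, and
(2) `Var[Ê_SJLT] = (2/k)(‖x−y‖₂⁴ − ‖x−y‖₄⁴) + 16(s/ε²)‖x−y‖₂² + 56ks²/ε⁴`;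
in particular `Var[Ê_SJLT] ≤ (2/k)‖x−y‖₂⁴ + 16(s/ε²)‖x−y‖₂² + 56ks²/ε⁴`. -/
theorem sjlt_private_estimator
    {Ω : Type*} [MeasurableSpace Ω] (Pr : Measure Ω) [IsProbabilityMeasure Pr]
    (s c d : ℕ) [NeZero s] [NeZero c]
    (G : Ω → (Fin s × Fin d) → Fin c × ℝ) (hGmeas : Measurable G)
    (hGlaw : Measure.map G Pr = Measure.pi (fun _ => hashSignMeasure c))
    (ε : ℝ) (hε : 0 < ε)
    (N : Ω → ((Fin c × Fin s) ⊕ (Fin c × Fin s)) → ℝ) (hNmeas : Measurable N)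
    (hNlaw : Measure.map N Pr = Measure.pi (fun _ => laplaceMeasure (Real.sqrt s / ε)))
    (hindep : IndepFun G N Pr)
    (x y : Fin d → ℝ) :
    (∫ ω, (∑ p : Fin c × Fin s,
          ((∑ j, sjltEntry (G ω) p.1 p.2 j * x j) + N ω (Sum.inl p)
            - ((∑ j, sjltEntry (G ω) p.1 p.2 j * y j) + N ω (Sum.inr p))) ^ 2)
        - 4 * ((c : ℝ) * (s : ℝ)) * (s : ℝ) / ε ^ 2 ∂Pr)
      = ∑ j, (x j - y j) ^ 2
    ∧ variance (fun ω =>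
        (∑ p : Fin c × Fin s,
          ((∑ j, sjltEntry (G ω) p.1 p.2 j * x j) + N ω (Sum.inl p)
            - ((∑ j, sjltEntry (G ω) p.1 p.2 j * y j) + N ω (Sum.inr p))) ^ 2)
        - 4 * ((c : ℝ) * (s : ℝ)) * (s : ℝ) / ε ^ 2) Pr
      = (2 / ((c : ℝ) * (s : ℝ)))
          * ((∑ j, (x j - y j) ^ 2) ^ 2 - ∑ j, (x j - y j) ^ 4)
        + 16 * ((s : ℝ) / ε ^ 2) * (∑ j, (x j - y j) ^ 2)
        + 56 * ((c : ℝ) * (s : ℝ)) * (s : ℝ) ^ 2 / ε ^ 4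
    ∧ variance (fun ω =>
        (∑ p : Fin c × Fin s,
          ((∑ j, sjltEntry (G ω) p.1 p.2 j * x j) + N ω (Sum.inl p)
            - ((∑ j, sjltEntry (G ω) p.1 p.2 j * y j) + N ω (Sum.inr p))) ^ 2)
        - 4 * ((c : ℝ) * (s : ℝ)) * (s : ℝ) / ε ^ 2) Pr
      ≤ (2 / ((c : ℝ) * (s : ℝ))) * (∑ j, (x j - y j) ^ 2) ^ 2
        + 16 * ((s : ℝ) / ε ^ 2) * (∑ j, (x j - y j) ^ 2)
        + 56 * ((c : ℝ) * (s : ℝ)) * (s : ℝ) ^ 2 / ε ^ 4 := by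
  have hs : (0 : ℝ) < s := by exact_mod_cast Nat.pos_of_neZero s
  have hc : (0 : ℝ) < c := by exact_mod_cast Nat.pos_of_neZero c
  have hb : 0 < √(s : ℝ) / ε := div_pos (Real.sqrt_pos.2 hs) hε
  have hb2 : (√(s : ℝ) / ε) ^ 2 = s / ε ^ 2 := by rw [div_pow, Real.sq_sqrt hs.le]
  have hb4 : (√(s : ℝ) / ε) ^ 4 = s ^ 2 / ε ^ 4 := by
    rw [show 4 = 2 * 2 from rfl, pow_mul, hb2, div_pow, ← pow_mul]
  have hU := hasNormMoments_sjlt (s := s) (c := c) fun j => x j - y j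
  have hW := hasNormMoments_noise (P := Fin c × Fin s) hb
  have hZ := (hU.comp ⟨hGmeas, hGlaw⟩).add (hW.comp ⟨hNmeas, hNlaw⟩)
    (hindep.comp hU.measurable hW.measurable)
  have hfun : ∀ ω, ∀ p : Fin c × Fin s,
      (∑ j, sjltEntry (G ω) p.1 p.2 j * x j) + N ω (Sum.inl p)
            - ((∑ j, sjltEntry (G ω) p.1 p.2 j * y j) + N ω (Sum.inr p))
        = ((fun ω (p : Fin c × Fin s) => ∑ j, sjltEntry (G ω) p.1 p.2 j * (x j - y j))
          + fun ω p => N ω (Sum.inl p) - N ω (Sum.inr p)) ω p := fun ω p => by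
    simp only [Pi.add_apply, mul_sub, sum_sub_distrib]
    ring
  simp only [hfun]
  have hvar := hZ.variance_normSq
  rw [← variance_sub_const hZ.memLp_normSq.aestronglyMeasurable
    (4 * ((c : ℝ) * (s : ℝ)) * (s : ℝ) / ε ^ 2)] at hvar
  have hmean := hZ.integral_normSq
  simp only [Pi.add_apply, sum_add_distrib, if_true, sum_const,
    card_univ, Fintype.card_prod, Fintype.card_fin, nsmul_eq_mul, hb2, Nat.cast_mul] at hmean
  have hfrob : ∑ p : Fin c × Fin s, ∑ q : Fin c × Fin s,
      (((fun p q => if p = q then (∑ j, (x j - y j) ^ 2) / (c * s) else 0)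
        + fun p q => if p = q then 4 * (√(s : ℝ) / ε) ^ 2 else 0 :
          Fin c × Fin s → Fin c × Fin s → ℝ) p q) ^ 2
      = c * s * ((∑ j, (x j - y j) ^ 2) / (c * s) + 4 * (s / ε ^ 2)) ^ 2 := by
    simp only [Pi.add_apply, ← ite_add_zero, ite_pow, hb2]
    simp
  have hvar' := hvar.trans (congrArg (fun t => _ + 2 * t) hfrob)
  rw [hb4] at hvar'
  have heq := hvar'.trans (b := _) (c := (2 / ((c : ℝ) * (s : ℝ)))
          * ((∑ j, (x j - y j) ^ 2) ^ 2 - ∑ j, (x j - y j) ^ 4)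
        + 16 * ((s : ℝ) / ε ^ 2) * (∑ j, (x j - y j) ^ 2)
        + 56 * ((c : ℝ) * (s : ℝ)) * (s : ℝ) ^ 2 / ε ^ 4) (by
    simp only [Fintype.card_prod, Fintype.card_fin, Nat.cast_mul]
    field_simp
    ring)
  refine ⟨?_, heq, heq.trans_le ?_⟩
  · rw [integral_sub (hZ.memLp_normSq.integrable (by norm_num)) (integrable_const _)]
    simp only [Pi.add_apply, hmean, integral_const, probReal_univ, one_smul]
    field_simp
    ring
  · have h4 : 0 ≤ ∑ j, (x j - y j) ^ 4 := sum_nonneg fun j _ => by positivity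
    gcongr
    linarith
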